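/- Let β_ℝ : L_ℝ → N_ℝ be a surjective linear map between finite-dimensional real vector spaces, and let Σ̂ and Σ be fans of polyhedral cones in L_ℝ and N_ℝ respectively such that σ̂ ↦ β_ℝ(σ̂) is a well-defined map from Σ̂ to Σ and is an isomorphism of posets (ordered by the face relation). Then for every cone σ̂ ∈ Σ̂ one has dim(span σ̂) = dim(span β_ℝ(σ̂)). -/

import Mathlib

/-- The convex cone generated by a set of vectors: all finite nonnegative
combinations of elements of `S`. -/
def coneSpan {V : Type*} [AddCommGroup V] [Module ℝ V] (S : Set V) : Set V :=
  { x | ∃ (t : Finset V) (c : V → ℝ), ↑t ⊆ S ∧ (∀ v, 0 ≤ c v) ∧ x = ∑ v ∈ t, c v • v }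

/-- A polyhedral cone: the cone generated by finitely many vectors. -/
def IsPolyCone {V : Type*} [AddCommGroup V] [Module ℝ V] (σ : Set V) : Prop :=
  ∃ S : Finset V, σ = coneSpan (S : Set V)

/-- `τ` is a face of the cone `σ`: it is cut out of `σ` by a linear functional
which is nonnegative on `σ`. -/
def IsFaceOf {V : Type*} [AddCommGroup V] [Module ℝ V] (τ σ : Set V) : Prop :=
  ∃ f : V →ₗ[ℝ] ℝ, (∀ x ∈ σ, 0 ≤ f x) ∧ τ = σ ∩ {x | f x = 0}

/-- A fan: a finite collection of strictly convex polyhedral cones, closed under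
taking faces, such that the intersection of any two cones is a face of each. -/
structure IsFan {V : Type*} [AddCommGroup V] [Module ℝ V] (F : Set (Set V)) : Prop where
  finite : F.Finite
  poly : ∀ σ ∈ F, IsPolyCone σ
  strictly_convex : ∀ σ ∈ F, σ ∩ {x | -x ∈ σ} ⊆ {0}
  face_mem : ∀ σ ∈ F, ∀ τ : Set V, IsFaceOf τ σ → τ ∈ F
  inter_face : ∀ σ₁ ∈ F, ∀ σ₂ ∈ F, IsFaceOf (σ₁ ∩ σ₂) σ₁

theorem subset_coneSpan {V : Type*} [AddCommGroup V] [Module ℝ V] (S : Set V) :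
    S ⊆ coneSpan S := by
  intro v hv
  exact ⟨{v}, fun _ => 1, by simpa using hv, fun _ => zero_le_one, by simp⟩

theorem coneSpan_subset_span {V : Type*} [AddCommGroup V] [Module ℝ V] (S : Set V) :
    coneSpan S ⊆ Submodule.span ℝ S := by
  rintro x ⟨t, c, ht, -, rfl⟩
  exact Submodule.sum_mem _ fun v hv =>
    Submodule.smul_mem _ _ (Submodule.subset_span (ht hv))

theorem span_coneSpan {V : Type*} [AddCommGroup V] [Module ℝ V] (S : Set V) :
    Submodule.span ℝ (coneSpan S) = Submodule.span ℝ S :=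
  le_antisymm (Submodule.span_le.2 (coneSpan_subset_span S))
    (Submodule.span_mono (subset_coneSpan S))

theorem nonneg_on_coneSpan {V : Type*} [AddCommGroup V] [Module ℝ V] {S : Set V}
    {f : V →ₗ[ℝ] ℝ} (hf : ∀ s ∈ S, 0 ≤ f s) : ∀ x ∈ coneSpan S, 0 ≤ f x := by
  rintro x ⟨t, c, ht, hc, rfl⟩
  rw [map_sum]
  refine Finset.sum_nonneg fun v hv => ?_
  rw [map_smul, smul_eq_mul]
  exact mul_nonneg (hc v) (hf v (ht hv))

/-- A finite set whose convex hull misses the origin lies in an open half-space. -/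
theorem exists_linear_pos_of_zero_notMem_convexHull {V : Type*} [AddCommGroup V] [Module ℝ V]
    [FiniteDimensional ℝ V] {S : Set V} (hS : S.Finite) (h0 : (0 : V) ∉ convexHull ℝ S) :
    ∃ f : V →ₗ[ℝ] ℝ, ∀ s ∈ S, 0 < f s := by
  let e : V ≃ₗ[ℝ] (Fin (Module.finrank ℝ V) → ℝ) := (Module.finBasis ℝ V).equivFun
  have h0' : (0 : Fin (Module.finrank ℝ V) → ℝ) ∉ convexHull ℝ (e '' S) := by
    have himage : e '' convexHull ℝ S = convexHull ℝ (e '' S) :=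
      LinearMap.image_convexHull e.toLinearMap S
    rw [← himage]
    rintro ⟨x, hx, hx0⟩
    rw [e.map_eq_zero_iff] at hx0
    exact h0 (hx0 ▸ hx)
  obtain ⟨f, u, hu, hf⟩ := geometric_hahn_banach_point_closed (convex_convexHull ℝ _)
    ((hS.image e).isClosed_convexHull ℝ) h0'
  refine ⟨f.toLinearMap ∘ₗ e.toLinearMap, fun s hs => ?_⟩
  rw [map_zero] at hu
  exact hu.trans (hf _ (subset_convexHull ℝ _ (Set.mem_image_of_mem e hs)))

/-- The nonzero generators of a strictly convex polyhedral cone do not have the origin in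
their convex hull. -/
theorem zero_notMem_convexHull_of_strictlyConvex {V : Type*} [AddCommGroup V] [Module ℝ V]
    {S : Finset V} (hS : coneSpan (S : Set V) ∩ {x | -x ∈ coneSpan (S : Set V)} ⊆ {0}) :
    (0 : V) ∉ convexHull ℝ ((S : Set V) \ {0}) := by
  classical
  rw [← Finset.coe_singleton, ← Finset.coe_sdiff, Finset.mem_convexHull']
  rintro ⟨w, hw, hw1, hw0⟩
  obtain ⟨y, hy, hwy⟩ : ∃ y ∈ S \ {0}, w y ≠ 0 := by
    by_contra! h
    rw [Finset.sum_eq_zero h] at hw1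
    exact zero_ne_one hw1
  have hyS : y ∈ S ∧ y ≠ 0 := by simpa using hy
  refine hyS.2 (hS ⟨subset_coneSpan _ hyS.1, (S \ {0}).erase y, fun v => (w y)⁻¹ * |w v|, ?_,
    fun v => mul_nonneg (inv_nonneg.2 (hw y hy)) (abs_nonneg _), ?_⟩)
  · intro v hv
    exact (Finset.mem_sdiff.1 (Finset.mem_of_mem_erase hv)).1
  · rw [← Finset.add_sum_erase _ _ hy] at hw0
    have hsum : ∑ v ∈ (S \ {0}).erase y, ((w y)⁻¹ * |w v|) • v =
        (w y)⁻¹ • ∑ v ∈ (S \ {0}).erase y, w v • v := by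
      rw [Finset.smul_sum]
      refine Finset.sum_congr rfl fun v hv => ?_
      rw [abs_of_nonneg (hw v (Finset.mem_of_mem_erase hv)), mul_smul]
    rw [hsum, eq_neg_of_add_eq_zero_right hw0, smul_neg, inv_smul_smul₀ hwy]

/-- A nonzero strictly convex polyhedral cone has a proper face. -/
theorem exists_nonneg_ne_zero {V : Type*} [AddCommGroup V] [Module ℝ V] [FiniteDimensional ℝ V]
    {S : Finset V} (hS : coneSpan (S : Set V) ∩ {x | -x ∈ coneSpan (S : Set V)} ⊆ {0})
    {s : V} (hs : s ∈ S) (hs0 : s ≠ 0) :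
    ∃ f : V →ₗ[ℝ] ℝ, (∀ x ∈ S, 0 ≤ f x) ∧ ∃ x ∈ S, f x ≠ 0 := by
  obtain ⟨f, hf⟩ := exists_linear_pos_of_zero_notMem_convexHull
    (S.finite_toSet.subset Set.sdiff_subset) (zero_notMem_convexHull_of_strictlyConvex hS)
  refine ⟨f, fun x hx => ?_, s, hs, (hf s ⟨hs, hs0⟩).ne'⟩
  by_cases hx0 : x = 0
  · simp [hx0]
  · exact (hf x ⟨hx, hx0⟩).le

/-- A supporting hyperplane whose face has codimension at least two can be rotated so that the
face becomes larger but remains proper. -/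
theorem exists_larger_face {V : Type*} [AddCommGroup V] [Module ℝ V] [FiniteDimensional ℝ V]
    {S : Finset V} {f : V →ₗ[ℝ] ℝ} (hf : ∀ x ∈ S, 0 ≤ f x) {x : V} (hx : x ∈ S)
    (hfx : f x ≠ 0)
    (hdim : Module.finrank ℝ (Submodule.span ℝ (coneSpan (S : Set V) ∩ {x | f x = 0})) + 1 <
      Module.finrank ℝ (Submodule.span ℝ (S : Set V))) :
    ∃ f' : V →ₗ[ℝ] ℝ, (∀ x ∈ S, 0 ≤ f' x) ∧ (∃ x ∈ S, f' x ≠ 0) ∧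
      Module.finrank ℝ (Submodule.span ℝ (coneSpan (S : Set V) ∩ {x | f x = 0})) <
      Module.finrank ℝ (Submodule.span ℝ (coneSpan (S : Set V) ∩ {x | f' x = 0})) := by
  classical
  set U := Submodule.span ℝ (coneSpan (S : Set V) ∩ {x | f x = 0})
  have hUf : ∀ y ∈ U, f y = 0 := by
    have : U ≤ LinearMap.ker f := Submodule.span_le.2 fun y hy => hy.2
    exact fun y hy => this hy
  obtain ⟨s, hs, hsU⟩ : ∃ s ∈ S, s ∉ U ⊔ Submodule.span ℝ {x} := by
    by_contra! h
    have h1 := Submodule.finrank_mono (Submodule.span_le.2 h : Submodule.span ℝ (S : Set V) ≤ _)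
    have h2 := Submodule.finrank_add_le_finrank_add_finrank U (Submodule.span ℝ {x})
    have h3 := finrank_span_le_card (R := ℝ) ({x} : Set V)
    simp only [Set.toFinset_singleton, Finset.card_singleton] at h3
    omega
  obtain ⟨g, hg, hgs⟩ : ∃ g : V →ₗ[ℝ] ℝ, (U ⊔ Submodule.span ℝ {x} ≤ LinearMap.ker g) ∧
      g s < 0 := by
    obtain ⟨g, hgs, hg⟩ := Submodule.exists_le_ker_of_notMem hsU
    rcases hgs.lt_or_gt with h | h
    · exact ⟨g, hg, h⟩
    · refine ⟨-g, fun y hy => ?_, by simpa using h⟩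
      simpa using hg hy
  have hgU : ∀ y ∈ U, g y = 0 := fun y hy => hg (Submodule.mem_sup_left hy)
  have hgx : g x = 0 := hg (Submodule.mem_sup_right (Submodule.mem_span_singleton_self x))
  obtain ⟨m, hm, hmin⟩ := Finset.exists_min_image (S.filter fun y => g y < 0)
    (fun y => f y / -g y) ⟨s, Finset.mem_filter.2 ⟨hs, hgs⟩⟩
  obtain ⟨hmS, hgm⟩ := Finset.mem_filter.1 hm
  set t := f m / -g m with ht
  have ht0 : 0 ≤ t := div_nonneg (hf m hmS) (by linarith)
  have hm0 : (f + t • g) m = 0 := by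
    simp only [LinearMap.add_apply, LinearMap.smul_apply, smul_eq_mul, ht]
    rw [div_neg, neg_mul, div_mul_cancel₀ _ hgm.ne, add_neg_cancel]
  refine ⟨f + t • g, fun y hy => ?_, ⟨x, hx, by simpa [hgx] using hfx⟩, ?_⟩
  · simp only [LinearMap.add_apply, LinearMap.smul_apply, smul_eq_mul]
    rcases lt_or_ge (g y) 0 with h | h
    · have h1 := hmin y (Finset.mem_filter.2 ⟨hy, h⟩)
      rw [le_div_iff₀ (by linarith)] at h1
      linarith
    · exact add_nonneg (hf y hy) (mul_nonneg ht0 h)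
  · refine Submodule.finrank_lt_finrank_of_lt (lt_of_le_of_ne ?_ fun heq => ?_)
    · refine Submodule.span_mono fun y hy => ⟨hy.1, ?_⟩
      have hyU : y ∈ U := Submodule.subset_span hy
      simp [hUf y hyU, hgU y hyU]
    · have hmU : m ∈ U := by
        rw [heq]
        exact Submodule.subset_span ⟨subset_coneSpan _ hmS, hm0⟩
      exact hgm.ne (hgU m hmU)

/-- Cutting with a hyperplane that does not contain the set lowers the dimension of the span. -/
theorem finrank_span_inter_ker_lt {V : Type*} [AddCommGroup V] [Module ℝ V]
    [FiniteDimensional ℝ V] {σ : Set V} {f : V →ₗ[ℝ] ℝ} {x : V} (hx : x ∈ σ) (hfx : f x ≠ 0) :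
    Module.finrank ℝ (Submodule.span ℝ (σ ∩ {x | f x = 0})) <
      Module.finrank ℝ (Submodule.span ℝ σ) := by
  refine Submodule.finrank_lt_finrank_of_lt
    (lt_of_le_of_ne (Submodule.span_mono Set.inter_subset_left) fun heq => hfx ?_)
  have hker : Submodule.span ℝ (σ ∩ {x | f x = 0}) ≤ LinearMap.ker f :=
    Submodule.span_le.2 fun y hy => hy.2
  exact hker (heq ▸ Submodule.subset_span hx)

theorem IsFaceOf.finrank_span_lt {V : Type*} [AddCommGroup V] [Module ℝ V]
    [FiniteDimensional ℝ V] {τ σ : Set V} (h : IsFaceOf τ σ) (hne : τ ≠ σ) :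
    Module.finrank ℝ (Submodule.span ℝ τ) < Module.finrank ℝ (Submodule.span ℝ σ) := by
  obtain ⟨f, -, rfl⟩ := h
  obtain ⟨x, hx, hfx⟩ : ∃ x ∈ σ, f x ≠ 0 := by
    by_contra! h
    exact hne (Set.inter_eq_left.2 h)
  exact finrank_span_inter_ker_lt hx hfx

/-- A nonzero strictly convex polyhedral cone has a facet. -/
theorem IsPolyCone.exists_facet {V : Type*} [AddCommGroup V] [Module ℝ V]
    [FiniteDimensional ℝ V] {σ : Set V} (hσ : IsPolyCone σ)
    (hconv : σ ∩ {x | -x ∈ σ} ⊆ {0}) (hpos : Module.finrank ℝ (Submodule.span ℝ σ) ≠ 0) :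
    ∃ τ, IsFaceOf τ σ ∧ Module.finrank ℝ (Submodule.span ℝ τ) + 1 =
      Module.finrank ℝ (Submodule.span ℝ σ) := by
  obtain ⟨S, rfl⟩ := hσ
  obtain ⟨s, hs, hs0⟩ : ∃ s ∈ S, s ≠ 0 := by
    by_contra! h
    apply hpos
    rw [span_coneSpan, Submodule.span_eq_bot.2 h, finrank_bot]
  obtain ⟨f, hf, x, hx, hfx⟩ := exists_nonneg_ne_zero hconv hs hs0
  induction hn : Module.finrank ℝ (Submodule.span ℝ (coneSpan (S : Set V))) -
      Module.finrank ℝ (Submodule.span ℝ (coneSpan (S : Set V) ∩ {x | f x = 0}))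
      using Nat.strong_induction_on generalizing f x with
  | _ n ih =>
    have hlt := finrank_span_inter_ker_lt (subset_coneSpan (S : Set V) hx) hfx
    rcases (Nat.succ_le_of_lt hlt).eq_or_lt with heq | hlt'
    · exact ⟨_, ⟨f, nonneg_on_coneSpan hf, rfl⟩, heq⟩
    · obtain ⟨f', hf', ⟨x', hx', hfx'⟩, hlarger⟩ :=
        exists_larger_face hf hx hfx (by rwa [span_coneSpan] at hlt')
      exact ih _ (by omega) f' hf' x' hx' hfx' rfl

/-- If `β_ℝ : L_ℝ → N_ℝ` is surjective linear and induces a well-defined map of fans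
`Σ̂ → Σ`, `σ̂ ↦ β_ℝ(σ̂)`, which is an isomorphism of posets for the face relation,
then `dim span σ̂ = dim span β_ℝ(σ̂)` for every `σ̂ ∈ Σ̂`. -/
theorem stmt0 {V W : Type*} [AddCommGroup V] [Module ℝ V] [FiniteDimensional ℝ V]
    [AddCommGroup W] [Module ℝ W] [FiniteDimensional ℝ W]
    (β : V →ₗ[ℝ] W) (hβ : Function.Surjective β)
    (Fhat : Set (Set V)) (F : Set (Set W)) (hFhat : IsFan Fhat) (hF : IsFan F)
    (hmap : ∀ σ ∈ Fhat, β '' σ ∈ F)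
    (hbij : Set.BijOn (fun σ : Set V => β '' σ) Fhat F)
    (hord : ∀ σ ∈ Fhat, ∀ τ ∈ Fhat, (IsFaceOf τ σ ↔ IsFaceOf (β '' τ) (β '' σ))) :
    ∀ σ ∈ Fhat, Module.finrank ℝ (Submodule.span ℝ σ) =
      Module.finrank ℝ (Submodule.span ℝ (β '' σ)) := by 
  intro σ hσ
  induction hn : Module.finrank ℝ (Submodule.span ℝ σ) using Nat.strong_induction_on
    generalizing σ with
  | _ n ih =>
    subst hn
    refine le_antisymm ?_ ?_
    · by_cases hpos : Module.finrank ℝ (Submodule.span ℝ σ) = 0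
      · omega
      · obtain ⟨τ, hτσ, hdim⟩ :=
          (hFhat.poly σ hσ).exists_facet (hFhat.strictly_convex σ hσ) hpos
        have hτ := hFhat.face_mem σ hσ τ hτσ
        have hτdim := ih _ (by omega) τ hτ rfl
        have hne : β '' τ ≠ β '' σ := by
          intro h
          have hτeq : τ = σ := hbij.injOn hτ hσ h
          subst hτeq
          omega
        have hlt := ((hord σ hσ τ hτ).1 hτσ).finrank_span_lt hne
        omega
    · rw [Submodule.span_image]
      exact Submodule.finrank_map_le β _
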